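/- Let M be a matroid on a finite ground set N, let f : 2^N → ℝ be a non-negative submodular set function, and let y ∈ [0,1]^(2^N) be a vector such that marg(y) ∈ P(M). Then there exists an independent set T of M with f(T) ≥ F(y). -/

import Mathlib

open scoped Classical

/-- A matroid on a finite ground set, given by its independent sets. -/
structure FinMatroid (α : Type*) [Fintype α] [DecidableEq α] where
  Indep : Finset α → Prop
  indep_empty : Indep ∅
  indep_subset : ∀ ⦃S T : Finset α⦄, Indep T → S ⊆ T → Indep S
  indep_exchange : ∀ ⦃S T : Finset α⦄, Indep S → Indep T → S.card < T.card →
    ∃ u ∈ T \ S, Indep (insert u S)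

variable {α : Type*} [Fintype α] [DecidableEq α]

/-- The rank of a set `A`: the maximum size of an independent subset of `A`. -/
noncomputable def FinMatroid.rank (M : FinMatroid α) (A : Finset α) : ℕ :=
  (A.powerset.filter fun S => M.Indep S).sup Finset.card

/-- A base of a matroid: an inclusion-wise maximal independent set. -/
def FinMatroid.IsBase (M : FinMatroid α) (B : Finset α) : Prop :=
  M.Indep B ∧ ∀ T : Finset α, M.Indep T → B ⊆ T → T = B

/-- The extended multilinear extension of a set function `f`, evaluated at a
vector `y` with one coordinate for each subset of the ground set. -/
noncomputable def extMulti (f : Finset α → ℝ) (y : Finset α → ℝ) : ℝ :=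
  ∑ J : Finset (Finset α), f (J.sup id) * ((∏ S ∈ J, y S) * ∏ S ∈ Jᶜ, (1 - y S))

/-- The standard multilinear extension of a set function `f`. -/
noncomputable def stdMulti (f : Finset α → ℝ) (x : α → ℝ) : ℝ :=
  ∑ S : Finset α, f S * ((∏ u ∈ S, x u) * ∏ u ∈ Sᶜ, (1 - x u))

/-- The marginal vector of `y`: `marg y u = 1 - ∏_{S ∋ u} (1 - y S)`. -/
noncomputable def marg (y : Finset α → ℝ) (u : α) : ℝ :=
  1 - ∏ S ∈ Finset.univ.filter (fun S : Finset α => u ∈ S), (1 - y S)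

/-- The characteristic vector of the coordinate indexed by the set `A`. -/
def chi (A : Finset α) : Finset α → ℝ := fun S => if S = A then 1 else 0

/-- The coordinate-wise probabilistic sum of two vectors. -/
def psum {ι : Type*} (a b : ι → ℝ) : ι → ℝ := fun i => 1 - (1 - a i) * (1 - b i)

/-- Membership of `x` in the matroid polytope `P(M)`. -/
def inMatroidPolytope (M : FinMatroid α) (x : α → ℝ) : Prop :=
  (∀ u, 0 ≤ x u) ∧ ∀ A : Finset α, ∑ u ∈ A, x u ≤ (M.rank A : ℝ)

open Finset in
theorem std_key {β : Type*} [Fintype β] [DecidableEq β] (f : Finset β → ℝ) (x : β → ℝ) (u : β) :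
    stdMulti f x = ∑ S ∈ (univ.erase u).powerset,
      ((1 - x u) * f (S.erase u) + x u * f (insert u S)) *
        ((∏ v ∈ S, x v) * ∏ v ∈ (univ.erase u) \ S, (1 - x v)) := by
  unfold stdMulti
  have h1 : (univ : Finset (Finset β)) = (insert u (univ.erase u)).powerset := by
    rw [insert_erase (mem_univ u), powerset_univ]
  rw [h1, sum_powerset_insert (notMem_erase u univ), ← sum_add_distrib]
  refine sum_congr rfl fun S hS => ?_
  have hu : u ∉ S := fun h => notMem_erase u univ (mem_powerset.1 hS h)
  have h2 : Sᶜ = insert u (univ.erase u \ S) := by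
    ext v; by_cases hv : v = u <;> simp [hv, hu]
  have h3 : (insert u S)ᶜ = univ.erase u \ S := by
    ext v; by_cases hv : v = u <;> simp [hv]
  rw [h3, h2, prod_insert (by simp), prod_insert hu, erase_eq_of_notMem hu]
  ring

theorem insert_erase_self' {β : Type*} [DecidableEq β] (T : Finset β) (u : β) :
    insert u (T.erase u) = insert u T := by
  ext v; by_cases hv : v = u <;> simp [hv]

theorem std_update {β : Type*} [Fintype β] [DecidableEq β] (f : Finset β → ℝ) (x x' : β → ℝ) (u : β)
    (hx : ∀ v, v ≠ u → x' v = x v)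
    (hf : ∀ S, f (insert u S) = f (S.erase u)) : stdMulti f x' = stdMulti f x := by
  rw [std_key f x u, std_key f x' u]
  refine Finset.sum_congr rfl fun S hS => ?_
  have e1 : ∏ v ∈ S, x' v = ∏ v ∈ S, x v := Finset.prod_congr rfl fun v hv => hx v (by
    have := Finset.mem_powerset.1 hS hv; simpa using this)
  have e2 : ∏ v ∈ Finset.univ.erase u \ S, (1 - x' v) = ∏ v ∈ Finset.univ.erase u \ S, (1 - x v) :=
    Finset.prod_congr rfl fun v hv => by
      rw [hx v (by simp at hv; exact hv.1)]
  rw [e1, e2, hf]; ring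

theorem std_lin {β : Type*} [Fintype β] [DecidableEq β] (f g : Finset β → ℝ) (a b : ℝ) (x : β → ℝ) :
    stdMulti (fun S => a * f S + b * g S) x = a * stdMulti f x + b * stdMulti g x := by
  unfold stdMulti
  rw [Finset.mul_sum, Finset.mul_sum, ← Finset.sum_add_distrib]
  exact Finset.sum_congr rfl fun S _ => by ring

theorem std_mono {β : Type*} [Fintype β] [DecidableEq β] (f g : Finset β → ℝ) (x : β → ℝ)
    (hx : ∀ v, 0 ≤ x v ∧ x v ≤ 1) (h : ∀ S, f S ≤ g S) : stdMulti f x ≤ stdMulti g x := by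
  unfold stdMulti
  refine Finset.sum_le_sum fun S _ => mul_le_mul_of_nonneg_right (h S) ?_
  exact mul_nonneg (Finset.prod_nonneg fun v _ => (hx v).1)
    (Finset.prod_nonneg fun v _ => sub_nonneg.2 (hx v).2)

theorem std_cond {β : Type*} [Fintype β] [DecidableEq β] (f : Finset β → ℝ) (x : β → ℝ) (u : β) :
    stdMulti f x = (1 - x u) * stdMulti (fun S => f (S.erase u)) x
      + x u * stdMulti (fun S => f (insert u S)) x := by
  rw [← std_lin, std_key f x u, std_key _ x u]
  refine Finset.sum_congr rfl fun S hS => ?_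
  have hu : u ∉ S := fun h => Finset.notMem_erase u Finset.univ (Finset.mem_powerset.1 hS h)
  simp only [Finset.erase_eq_of_notMem hu, Finset.erase_insert hu, Finset.insert_idem]
  ring

theorem std_ind {β : Type*} [Fintype β] [DecidableEq β] (f : Finset β → ℝ) (x : β → ℝ) (T : Finset β)
    (h1 : ∀ v ∈ T, x v = 1) (h0 : ∀ v, v ∉ T → x v = 0) : stdMulti f x = f T := by
  unfold stdMulti
  rw [Finset.sum_eq_single T]
  · rw [Finset.prod_congr rfl h1, Finset.prod_congr (s₂ := Tᶜ) (g := fun _ => (1:ℝ)) rfl]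
    · simp
    · intro v hv; rw [h0 v (by simpa using hv)]; ring
  · intro S _ hS
    by_cases h : S ⊆ T
    · have : ∃ v ∈ T, v ∉ S := by
        by_contra! hh; exact hS (Finset.Subset.antisymm h hh)
      obtain ⟨v, hv, hvS⟩ := this
      rw [Finset.prod_eq_zero (s := Sᶜ) (i := v) (by simpa using hvS) (by rw [h1 v hv]; ring)]
      ring
    · obtain ⟨v, hv, hvT⟩ := Finset.not_subset.1 h
      rw [Finset.prod_eq_zero hv (h0 v hvT)]; ring
  · simp

theorem std_cont {β : Type*} [Fintype β] [DecidableEq β] (f : Finset β → ℝ) :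
    Continuous (fun x : β → ℝ => stdMulti f x) := by
  unfold stdMulti
  fun_prop

theorem lemA {β : Type*} [Fintype β] [DecidableEq β] (p : ℝ) (hp0 : 0 ≤ p) (hp1 : p ≤ 1)
    (x : β → ℝ) (hx : ∀ v, 0 ≤ x v ∧ x v ≤ 1) (S : Finset β) :
    ∀ h : Finset β → ℝ, (∀ A B : Finset β, h (A ∪ B) + h (A ∩ B) ≤ h A + h B) →
    (1 - p) * stdMulti h x + p * stdMulti (fun R => h (R ∪ S)) x
      ≤ stdMulti h (fun u => if u ∈ S then 1 - (1 - x u) * (1 - p) else x u) := by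
  induction S using Finset.induction_on with
  | empty => intro h _; simp; linarith
  | insert u S hu ih =>
    intro h hs
    set z : β → ℝ := fun v => if v ∈ S then 1 - (1 - x v) * (1 - p) else x v with hz
    set z' : β → ℝ := fun v => if v ∈ insert u S then 1 - (1 - x v) * (1 - p) else x v with hz'
    have hz'u : z' u = 1 - (1 - x u) * (1 - p) := by simp [hz']
    have hne : ∀ v, v ≠ u → z' v = z v := by
      intro v hv; simp [hz, hz', hv]
    have i0 := ih (fun T => h (T.erase u)) (fun A B => by
      have := hs (A.erase u) (B.erase u)
      have a : A.erase u ∩ B.erase u = (A ∩ B).erase u := by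
        ext v; by_cases hv : v = u <;> simp [hv]
      rwa [← Finset.erase_union_distrib, a] at this)
    have i1 := ih (fun T => h (insert u T)) (fun A B => by
      have := hs (insert u A) (insert u B)
      rwa [← Finset.insert_union_distrib, ← Finset.insert_inter_distrib] at this)
    rw [std_cond h z' u, std_cond h x u, hz'u,
      std_update (fun T => h (T.erase u)) z z' u hne (by intro T; simp),
      std_update (fun T => h (insert u T)) z z' u hne (by
        intro T; simp [insert_erase_self'])]
    have e : stdMulti (fun R => h (R ∪ insert u S)) x = stdMulti (fun R => h (insert u (R ∪ S))) x := by
      congr 1; funext R; rw [Finset.union_insert]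
    rw [e]
    have key := std_mono
      (fun T => 1 * h (insert u (T ∪ S)) + 1 * h (T.erase u))
      (fun T => 1 * h (insert u T) + 1 * h ((T ∪ S).erase u)) x hx (fun T => by
        have := hs (insert u T) ((T ∪ S).erase u)
        have a1 : insert u T ∪ (T ∪ S).erase u = insert u (T ∪ S) := by
          ext v; by_cases hv : v = u <;> simp [hv]
        have a2 : insert u T ∩ (T ∪ S).erase u = T.erase u := by
          ext v; by_cases hv : v = u <;> simp [hv]
          tauto
        rw [a1, a2] at this
        linarith)
    rw [std_lin, std_lin] at key
    have hxu := hx u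
    have c0 : 0 ≤ (1 - p) * (1 - x u) := mul_nonneg (by linarith) (by linarith)
    have c1 : 0 ≤ 1 - (1 - x u) * (1 - p) := by nlinarith
    have j0 := mul_le_mul_of_nonneg_left i0 c0
    have j1 := mul_le_mul_of_nonneg_left i1 c1
    have j2 := mul_le_mul_of_nonneg_left key (mul_nonneg hp0 c0)
    nlinarith

theorem part1 (f : Finset α → ℝ)
    (hf_submod : ∀ S T : Finset α, f (S ∪ T) + f (S ∩ T) ≤ f S + f T) (K : Finset (Finset α)) :
    ∀ (y : Finset α → ℝ), (∀ S, 0 ≤ y S ∧ y S ≤ 1) → (∀ S, S ∉ K → y S = 0) →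
    ∀ (x : α → ℝ), (∀ v, 0 ≤ x v ∧ x v ≤ 1) →
    stdMulti (fun J : Finset (Finset α) => stdMulti (fun R => f (R ∪ J.sup id)) x) y
      ≤ stdMulti f (fun u => 1 - (1 - x u) * ∏ S ∈ K, if u ∈ S then 1 - y S else 1) := by
  induction K using Finset.induction_on with
  | empty =>
    intro y hy h0 x hx
    rw [std_ind _ y ∅ (by simp) (fun S _ => h0 S (by simp))]
    simp
  | insert S K hS ih =>
    intro y hy h0 x hx
    set p := y S with hp
    set y' : Finset α → ℝ := fun T => if T = S then 0 else y T with hy'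
    set x' : α → ℝ := fun u => if u ∈ S then 1 - (1 - x u) * (1 - p) else x u with hx'
    set g : Finset (Finset α) → ℝ := fun J => stdMulti (fun R => f (R ∪ J.sup id)) x with hg
    have hpp := hy S
    have b1 : ∀ T, 0 ≤ y' T ∧ y' T ≤ 1 := by
      intro T; simp only [hy']; split_ifs
      · simp
      · exact hy T
    have b2 : ∀ v, 0 ≤ x' v ∧ x' v ≤ 1 := by
      intro v; simp only [hx']
      have := hx v
      split_ifs
      · constructor <;> nlinarith
      · exact this
    have I := ih y' b1 (by
      intro T hT; simp only [hy']; split_ifs with h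
      · rfl
      · exact h0 T (by simp [h, hT])) x' b2
    have e1 : stdMulti f (fun u => 1 - (1 - x' u) * ∏ S ∈ K, if u ∈ S then 1 - y' S else 1)
        = stdMulti f (fun u => 1 - (1 - x u) * ∏ S ∈ insert S K, if u ∈ S then 1 - y S else 1) := by
      congr 1; funext u
      rw [Finset.prod_insert hS]
      have : (∏ S ∈ K, if u ∈ S then 1 - y' S else 1) = ∏ S ∈ K, if u ∈ S then 1 - y S else 1 := by
        refine Finset.prod_congr rfl fun T hT => ?_
        have : T ≠ S := fun h => hS (h ▸ hT)
        simp [hy', this]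
      rw [this]
      simp only [hx']
      split_ifs <;> ring
    rw [← e1]
    refine le_trans ?_ I
    have hne : ∀ T, T ≠ S → y T = y' T := by intro T hT; simp [hy', hT]
    have q0 : stdMulti g y' = stdMulti (fun J => g (J.erase S)) y' := by
      rw [std_cond g y' S]; simp [hy']
    rw [std_cond g y S, std_update (fun J => g (J.erase S)) y' y S hne (by intro T; simp),
      std_update (fun J => g (insert S J)) y' y S hne (by intro T; simp [insert_erase_self']), ← q0, ← std_lin]
    refine std_mono _ _ _ b1 fun J => ?_
    have A := lemA p hpp.1 hpp.2 x hx S (fun R => f (R ∪ J.sup id)) (fun A B => by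
      have := hf_submod (A ∪ J.sup id) (B ∪ J.sup id)
      rwa [← Finset.union_union_distrib_right, ← Finset.inter_union_distrib_right] at this)
    refine le_trans (le_of_eq ?_) A
    simp only [hg]
    congr 2
    congr 1
    funext R
    congr 1
    rw [Finset.sup_insert, Finset.union_assoc]
    rfl

theorem extMulti_le (f : Finset α → ℝ)
    (hf_submod : ∀ S T : Finset α, f (S ∪ T) + f (S ∩ T) ≤ f S + f T)
    (y : Finset α → ℝ) (hy : ∀ S, 0 ≤ y S ∧ y S ≤ 1) :
    extMulti f y ≤ stdMulti f (marg y) := by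
  have h := part1 f hf_submod Finset.univ y hy (by simp) (fun _ => 0) (by simp)
  have e1 : extMulti f y = stdMulti (fun J : Finset (Finset α) => stdMulti (fun R => f (R ∪ J.sup id)) (fun _ => 0)) y := by
    have : (fun J : Finset (Finset α) => stdMulti (fun R => f (R ∪ J.sup id)) (fun _ => 0))
        = fun J => f (J.sup id) := by
      funext J
      rw [std_ind _ _ ∅ (by simp) (by simp)]; simp
    rw [this]; rfl
  have e2 : marg y = (fun u => 1 - (1 - (0:ℝ)) * ∏ S, if u ∈ S then 1 - y S else 1) := by
    funext u
    unfold marg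
    rw [Finset.prod_filter]; ring_nf
  rw [e1, e2]; exact h

theorem card_le_rank (M : FinMatroid α) {A S : Finset α} (h : S ⊆ A) (hS : M.Indep S) :
    S.card ≤ M.rank A := by
  unfold FinMatroid.rank
  exact Finset.le_sup (f := Finset.card) (by simp [h, hS])

theorem exists_rank (M : FinMatroid α) (A : Finset α) :
    ∃ S ⊆ A, M.Indep S ∧ S.card = M.rank A := by
  unfold FinMatroid.rank
  obtain ⟨S, hS, h⟩ := Finset.exists_mem_eq_sup (A.powerset.filter fun S => M.Indep S)
    ⟨∅, by simp [M.indep_empty]⟩ Finset.card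
  simp at hS
  exact ⟨S, hS.1, hS.2, h.symm⟩

theorem extend_rank (M : FinMatroid α) {A I : Finset α} (hI : M.Indep I) (hA : I ⊆ A) :
    ∃ J, I ⊆ J ∧ J ⊆ A ∧ M.Indep J ∧ J.card = M.rank A := by
  obtain ⟨J, hJ, hmax⟩ := Finset.exists_max_image
    (A.powerset.filter fun S => M.Indep S ∧ I ⊆ S) Finset.card ⟨I, by simp [hI, hA]⟩
  simp only [Finset.mem_filter, Finset.mem_powerset] at hJ hmax
  obtain ⟨hJA, hJi, hIJ⟩ := hJ
  refine ⟨J, hIJ, hJA, hJi, le_antisymm (card_le_rank M hJA hJi) ?_⟩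
  by_contra! hlt
  obtain ⟨K, hKA, hKi, hK⟩ := exists_rank M A
  obtain ⟨u, hu, hui⟩ := M.indep_exchange hJi hKi (by omega)
  rw [Finset.mem_sdiff] at hu
  have := hmax (insert u J) ⟨Finset.insert_subset (hKA hu.1) hJA, hui,
    hIJ.trans (Finset.subset_insert _ _)⟩
  rw [Finset.card_insert_of_notMem hu.2] at this
  omega

theorem rank_submod (M : FinMatroid α) (A B : Finset α) :
    M.rank (A ∪ B) + M.rank (A ∩ B) ≤ M.rank A + M.rank B := by
  obtain ⟨I, hI, hIi, hIc⟩ := exists_rank M (A ∩ B)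
  obtain ⟨J, hIJ, hJ, hJi, hJc⟩ := extend_rank M (A := A ∪ B) hIi
    (hI.trans (Finset.inter_subset_left.trans Finset.subset_union_left))
  have h1 := card_le_rank M (Finset.inter_subset_right (s₁ := J) (s₂ := A))
    (M.indep_subset hJi Finset.inter_subset_left)
  have h2 := card_le_rank M (Finset.inter_subset_right (s₁ := J) (s₂ := B))
    (M.indep_subset hJi Finset.inter_subset_left)
  have h3 := Finset.card_union_add_card_inter (J ∩ A) (J ∩ B)
  rw [← Finset.inter_union_distrib_left, Finset.inter_eq_left.2 hJ] at h3
  have h4 : I.card ≤ ((J ∩ A) ∩ (J ∩ B)).card := Finset.card_le_card fun v hv => by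
    have := hI hv
    have := hIJ hv
    simp_all
  omega

theorem finrank_le_card (M : FinMatroid α) (A : Finset α) : M.rank A ≤ A.card := by
  obtain ⟨S, h, _, hc⟩ := exists_rank M A
  exact hc ▸ Finset.card_le_card h

theorem poly_le_one (M : FinMatroid α) (x : α → ℝ) (hx : inMatroidPolytope M x) (u : α) :
    x u ≤ 1 := by
  have h := hx.2 {u}
  have h2 : (M.rank {u} : ℝ) ≤ 1 := by exact_mod_cast (finrank_le_card M {u}).trans (by simp)
  simp at h
  linarith

theorem tight_inter (M : FinMatroid α) (x : α → ℝ) (hx : inMatroidPolytope M x) (A B : Finset α)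
    (hA : ∑ u ∈ A, x u = M.rank A) (hB : ∑ u ∈ B, x u = M.rank B) :
    ∑ u ∈ A ∩ B, x u = M.rank (A ∩ B) := by
  have h1 := hx.2 (A ∪ B)
  have h2 := hx.2 (A ∩ B)
  have h3 : ((M.rank (A ∪ B) + M.rank (A ∩ B) : ℕ) : ℝ) ≤ ((M.rank A + M.rank B : ℕ) : ℝ) :=
    Nat.cast_le.2 (rank_submod M A B)
  have h4 := Finset.sum_union_inter (s₁ := A) (s₂ := B) (f := x)
  push_cast at h3
  linarith

theorem poly_compact (M : FinMatroid α) : IsCompact {x | inMatroidPolytope M x} := by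
  refine IsCompact.of_isClosed_subset (isCompact_univ_pi (fun _ : α => isCompact_Icc (a := (0:ℝ)) (b := 1))) ?_ ?_
  · unfold inMatroidPolytope
    simp only [Set.ofPred_and, Set.ofPred_forall]
    refine IsClosed.inter (isClosed_iInter fun u => isClosed_le (by fun_prop) (by fun_prop))
      (isClosed_iInter fun A => isClosed_le (by fun_prop) (by fun_prop))
  · intro x hx u _
    exact ⟨hx.1 u, poly_le_one M x hx u⟩

/-- Feasible moves. -/
theorem poly_move (M : FinMatroid α) (x d : α → ℝ) (hx : inMatroidPolytope M x)
    (h0 : ∀ u, x u = 0 → 0 ≤ d u)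
    (h1 : ∀ A : Finset α, ∑ u ∈ A, x u = M.rank A → ∑ u ∈ A, d u ≤ 0) :
    ∀ᶠ e in nhdsWithin (0:ℝ) (Set.Ioi 0), inMatroidPolytope M (fun u => x u + e * d u) := by
  unfold inMatroidPolytope
  refine Filter.Eventually.and (Filter.eventually_all.2 fun u => ?_)
    (Filter.eventually_all.2 fun A => ?_)
  · rcases (hx.1 u).eq_or_lt with h | h
    · filter_upwards [self_mem_nhdsWithin] with e he
      rw [← h]
      have := mul_nonneg (le_of_lt he) (h0 u h.symm)
      linarith
    · have : Filter.Tendsto (fun e : ℝ => x u + e * d u) (nhds 0) (nhds (x u + 0 * d u)) :=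
        Continuous.tendsto (f := fun e : ℝ => x u + e * d u) (by fun_prop) 0
      refine Filter.Eventually.filter_mono nhdsWithin_le_nhds ?_
      filter_upwards [this.eventually (lt_mem_nhds (by simpa using h))] with e he
      exact he.le
  · rcases (hx.2 A).eq_or_lt with h | h
    · filter_upwards [self_mem_nhdsWithin] with e he
      rw [Finset.sum_add_distrib, ← Finset.mul_sum, h]
      have := mul_nonneg (le_of_lt he) (neg_nonneg.2 (h1 A h))
      linarith
    · have : Filter.Tendsto (fun e : ℝ => ∑ u ∈ A, (x u + e * d u)) (nhds 0)
          (nhds (∑ u ∈ A, (x u + 0 * d u))) :=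
        Continuous.tendsto (f := fun e : ℝ => ∑ u ∈ A, (x u + e * d u)) (by fun_prop) 0
      refine Filter.Eventually.filter_mono nhdsWithin_le_nhds ?_
      filter_upwards [this.eventually (gt_mem_nhds (by simpa using h))] with e he
      exact he.le

theorem move_one (f : Finset α → ℝ) (x : α → ℝ) (u : α) (e : ℝ) :
    stdMulti f (fun w => x w + e * (if w = u then 1 else 0))
     + stdMulti f (fun w => x w + e * -(if w = u then 1 else 0)) = 2 * stdMulti f x := by
  rw [std_cond f x u, std_cond f (fun w => x w + e * (if w = u then 1 else 0)) u,
    std_cond f (fun w => x w + e * -(if w = u then 1 else 0)) u]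
  rw [std_update (fun S => f (S.erase u)) x (fun w => x w + e * (if w = u then 1 else 0)) u
      (by intro v hv; simp [hv]) (by intro T; simp [insert_erase_self']),
    std_update (fun S => f (S.erase u)) x (fun w => x w + e * -(if w = u then 1 else 0)) u
      (by intro v hv; simp [hv]) (by intro T; simp [insert_erase_self']),
    std_update (fun S => f (insert u S)) x (fun w => x w + e * (if w = u then 1 else 0)) u
      (by intro v hv; simp [hv]) (by intro T; simp [insert_erase_self']),
    std_update (fun S => f (insert u S)) x (fun w => x w + e * -(if w = u then 1 else 0)) u
      (by intro v hv; simp [hv]) (by intro T; simp [insert_erase_self'])]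
  simp
  ring

theorem std_cond2 (f : Finset α → ℝ) (x x' : α → ℝ) (u v : α) (huv : u ≠ v)
    (hx : ∀ w, w ≠ u → w ≠ v → x' w = x w) :
    stdMulti f x' = (1 - x' u) * ((1 - x' v) * stdMulti (fun S => f ((S.erase v).erase u)) x
        + x' v * stdMulti (fun S => f ((insert v S).erase u)) x)
      + x' u * ((1 - x' v) * stdMulti (fun S => f (insert u (S.erase v))) x
        + x' v * stdMulti (fun S => f (insert u (insert v S))) x) := by
  set m : α → ℝ := fun w => if w = u then x u else x' w with hm
  have hm1 : ∀ w, w ≠ u → x' w = m w := by intro w hw; simp [hm, hw]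
  have hm2 : ∀ w, w ≠ v → m w = x w := by
    intro w hw; simp only [hm]; split_ifs with h
    · rw [h]
    · exact hx w h hw
  rw [std_cond f x' u, std_cond (fun S => f (S.erase u)) x' v,
    std_cond (fun S => f (insert u S)) x' v]
  rw [std_update (fun S => f ((S.erase v).erase u)) m x' u hm1 (by
      intro T; congr 1; ext w; by_cases h1 : w = u <;> by_cases h2 : w = v <;> simp [h1, h2]),
    std_update (fun S => f ((insert v S).erase u)) m x' u hm1 (by
      intro T; congr 1; ext w; by_cases h1 : w = u <;> by_cases h2 : w = v <;> simp [h1, h2]),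
    std_update (fun S => f (insert u (S.erase v))) m x' u hm1 (by
      intro T; congr 1; ext w; by_cases h1 : w = u <;> by_cases h2 : w = v <;> simp [h1, h2]),
    std_update (fun S => f (insert u (insert v S))) m x' u hm1 (by
      intro T; congr 1; ext w; by_cases h1 : w = u <;> by_cases h2 : w = v <;> simp [h1, h2])]
  rw [std_update (fun S => f ((S.erase v).erase u)) x m v hm2 (by
      intro T; congr 1; ext w; by_cases h1 : w = u <;> by_cases h2 : w = v <;> simp [h1, h2]),
    std_update (fun S => f ((insert v S).erase u)) x m v hm2 (by
      intro T; congr 1; ext w; by_cases h1 : w = u <;> by_cases h2 : w = v <;> simp [h1, h2]),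
    std_update (fun S => f (insert u (S.erase v))) x m v hm2 (by
      intro T; congr 1; ext w; by_cases h1 : w = u <;> by_cases h2 : w = v <;> simp [h1, h2]),
    std_update (fun S => f (insert u (insert v S))) x m v hm2 (by
      intro T; congr 1; ext w; by_cases h1 : w = u <;> by_cases h2 : w = v <;> simp [h1, h2])]

theorem move_two (f : Finset α → ℝ)
    (hf : ∀ S T : Finset α, f (S ∪ T) + f (S ∩ T) ≤ f S + f T)
    (x : α → ℝ) (hx : ∀ v, 0 ≤ x v ∧ x v ≤ 1) (u v : α) (huv : u ≠ v) (e : ℝ) :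
    2 * stdMulti f x ≤
    stdMulti f (fun w => x w + e * ((if w = u then 1 else 0) - (if w = v then 1 else 0)))
     + stdMulti f (fun w => x w + e * -((if w = u then 1 else 0) - (if w = v then 1 else 0))) := by
  rw [std_cond2 f x x u v huv (by simp),
    std_cond2 f x (fun w => x w + e * ((if w = u then 1 else 0) - (if w = v then 1 else 0))) u v huv
      (by intro w h1 h2; simp [h1, h2]),
    std_cond2 f x (fun w => x w + e * -((if w = u then 1 else 0) - (if w = v then 1 else 0))) u v huv
      (by intro w h1 h2; simp [h1, h2])]
  simp only [huv, huv.symm, if_true, if_false]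
  have key := std_mono
    (fun S => 1 * f (insert u (insert v S)) + 1 * f ((S.erase v).erase u))
    (fun S => 1 * f (insert u (S.erase v)) + 1 * f ((insert v S).erase u)) x hx (fun T => by
      have := hf (insert u (T.erase v)) ((insert v T).erase u)
      have a1 : insert u (T.erase v) ∪ (insert v T).erase u = insert u (insert v T) := by
        ext w; by_cases h1 : w = u <;> by_cases h2 : w = v <;> simp [h1, h2, em]
      have a2 : insert u (T.erase v) ∩ (insert v T).erase u = (T.erase v).erase u := by
        ext w; by_cases h1 : w = u <;> by_cases h2 : w = v <;> simp [h1, h2, huv]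
      rw [a1, a2] at this
      linarith)
  rw [std_lin, std_lin] at key
  have := mul_le_mul_of_nonneg_left key (sq_nonneg e)
  nlinarith

theorem part2 (M : FinMatroid α) (f : Finset α → ℝ)
    (hf : ∀ S T : Finset α, f (S ∪ T) + f (S ∩ T) ≤ f S + f T)
    (x₀ : α → ℝ) (hx₀ : inMatroidPolytope M x₀) :
    ∃ T : Finset α, M.Indep T ∧ stdMulti f x₀ ≤ f T := by
  obtain ⟨x₁, hx₁, hmax₁⟩ := (poly_compact M).exists_isMaxOn ⟨x₀, hx₀⟩ (std_cont f).continuousOn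
  have hc : IsCompact ({x | inMatroidPolytope M x} ∩ {x | stdMulti f x₁ ≤ stdMulti f x}) :=
    (poly_compact M).inter_right (isClosed_le continuous_const (std_cont f))
  obtain ⟨x, hx, hmax⟩ := hc.exists_isMaxOn ⟨x₁, hx₁, le_refl (stdMulti f x₁)⟩
    (f := fun x : α → ℝ => ∑ u, x u ^ 2) (by fun_prop)
  obtain ⟨hxP, hx1⟩ := hx
  have hx1 : stdMulti f x₁ ≤ stdMulti f x := hx1
  have hxP : inMatroidPolytope M x := hxP
  have hb : ∀ v, 0 ≤ x v ∧ x v ≤ 1 := fun v => ⟨hxP.1 v, poly_le_one M x hxP v⟩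
  -- no feasible two-sided move along which stdMulti is convex
  have nomove : ∀ d : α → ℝ, (∀ e, 2 * stdMulti f x ≤ stdMulti f (fun w => x w + e * d w)
      + stdMulti f (fun w => x w + e * -d w)) →
      (∀ u, x u = 0 → d u = 0) →
      (∀ A : Finset α, ∑ u ∈ A, x u = M.rank A → ∑ u ∈ A, d u = 0) → ∀ u, d u = 0 := by
    intro d hd h0 h1 u
    by_contra hu
    have m1 := poly_move M x d hxP (fun w hw => (h0 w hw).ge) (fun A hA => (h1 A hA).le)
    have m2 := poly_move M x (fun w => -d w) hxP (fun w hw => by simp [h0 w hw])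
      (fun A hA => by simp [h1 A hA])
    obtain ⟨e, ⟨he1, he2⟩, he⟩ := ((m1.and m2).and self_mem_nhdsWithin).exists
    have he : 0 < e := he
    have g1 : stdMulti f (fun w => x w + e * d w) ≤ stdMulti f x₁ := hmax₁ he1
    have g2 : stdMulti f (fun w => x w + e * -d w) ≤ stdMulti f x₁ := hmax₁ he2
    have g3 := hd e
    have k1 : ∑ w, (x w + e * d w) ^ 2 ≤ ∑ w, x w ^ 2 :=
      hmax (show (fun w => x w + e * d w) ∈ _ from ⟨he1, by
        show stdMulti f x₁ ≤ stdMulti f (fun w => x w + e * d w); linarith⟩)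
    have k2 : ∑ w, (x w + e * -d w) ^ 2 ≤ ∑ w, x w ^ 2 :=
      hmax (show (fun w => x w + e * -d w) ∈ _ from ⟨he2, by
        show stdMulti f x₁ ≤ stdMulti f (fun w => x w + e * -d w); linarith⟩)
    have k3 : ∑ w, (x w + e * d w) ^ 2 + ∑ w, (x w + e * -d w) ^ 2
        = 2 * ∑ w, x w ^ 2 + 2 * e ^ 2 * ∑ w, d w ^ 2 := by
      rw [Finset.mul_sum, Finset.mul_sum, ← Finset.sum_add_distrib, ← Finset.sum_add_distrib]
      exact Finset.sum_congr rfl fun w _ => by ring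
    have k4 : 0 < ∑ w, d w ^ 2 := Finset.sum_pos' (fun w _ => sq_nonneg _)
      ⟨u, Finset.mem_univ u, by positivity⟩
    have : 0 < 2 * e ^ 2 * ∑ w, d w ^ 2 := by positivity
    linarith
  have hint : ∀ u, x u = 0 ∨ x u = 1 := by
    by_contra! hfrac
    obtain ⟨u₀, hu0, hu1⟩ := hfrac
    by_cases ht : ∃ A : Finset α, ∑ u ∈ A, x u = M.rank A ∧ ∃ u ∈ A, x u ≠ 0 ∧ x u ≠ 1
    · obtain ⟨A, hA, hAmin⟩ := Finset.exists_min_image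
        (Finset.univ.filter fun A : Finset α => ∑ u ∈ A, x u = M.rank A ∧ ∃ u ∈ A, x u ≠ 0 ∧ x u ≠ 1)
        Finset.card (by obtain ⟨A, hA⟩ := ht; exact ⟨A, by simpa using hA⟩)
      simp only [Finset.mem_filter, Finset.mem_univ, true_and] at hA hAmin
      obtain ⟨hAt, u, huA, hu0, hu1⟩ := hA
      have hmem : ∀ B : Finset α, ∑ u ∈ B, x u = M.rank B → (∃ u ∈ A ∩ B, x u ≠ 0 ∧ x u ≠ 1) →
          A ⊆ B := by
        intro B hB hu
        have := hAmin (A ∩ B) ⟨tight_inter M x hxP A B hAt hB, hu⟩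
        have := Finset.eq_of_subset_of_card_le Finset.inter_subset_left this
        exact Finset.inter_eq_left.1 this
      have hv : ∃ v ∈ A, v ≠ u ∧ x v ≠ 0 ∧ x v ≠ 1 := by
        by_contra! hno
        have e1 : ∑ w ∈ A.erase u, x w = ∑ w ∈ A.erase u, (((if x w = 0 then 0 else 1 : ℤ)) : ℝ) := by
          refine Finset.sum_congr rfl fun w hw => ?_
          rw [Finset.mem_erase] at hw
          by_cases h : x w = 0
          · simp [h]
          · simp [h, hno w hw.2 hw.1 h]
        have e2 := Finset.add_sum_erase A x huA
        rw [e1, hAt, ← Int.cast_sum] at e2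
        set z := ∑ w ∈ A.erase u, (if x w = 0 then 0 else 1 : ℤ)
        have e3 : x u = (((M.rank A : ℤ) - z : ℤ) : ℝ) := by push_cast; linarith
        have hbu := hb u
        have l0 : 0 < x u := lt_of_le_of_ne hbu.1 (Ne.symm hu0)
        have l1 : x u < 1 := lt_of_le_of_ne hbu.2 hu1
        rw [e3] at l0 l1
        have l0' : (0:ℤ) < (M.rank A : ℤ) - z := by exact_mod_cast l0
        have l1' : (M.rank A : ℤ) - z < 1 := by exact_mod_cast l1
        omega
      obtain ⟨v, hvA, hvu, hv0, hv1⟩ := hv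
      have := nomove (fun w => (if w = u then 1 else 0) - (if w = v then 1 else 0))
        (fun e => move_two f hf x hb u v hvu.symm e)
        (by
          intro w hw
          have h1 : w ≠ u := fun h => hu0 (h ▸ hw)
          have h2 : w ≠ v := fun h => hv0 (h ▸ hw)
          simp [h1, h2])
        (by
          intro B hB
          rw [Finset.sum_sub_distrib, Finset.sum_ite_eq', Finset.sum_ite_eq']
          have : u ∈ B ↔ v ∈ B :=
            ⟨fun h => hmem B hB ⟨u, Finset.mem_inter.2 ⟨huA, h⟩, hu0, hu1⟩ hvA,
             fun h => hmem B hB ⟨v, Finset.mem_inter.2 ⟨hvA, h⟩, hv0, hv1⟩ huA⟩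
          simp [this]) u
      simp [hvu.symm] at this
    · push Not at ht
      have := nomove (fun w => if w = u₀ then 1 else 0)
        (fun e => (move_one f x u₀ e).ge)
        (by
          intro w hw
          have h1 : w ≠ u₀ := fun h => hu0 (h ▸ hw)
          simp [h1])
        (by
          intro B hB
          rw [Finset.sum_ite_eq', if_neg]
          exact fun h => hu1 (ht B hB u₀ h hu0)) u₀
      simp at this
  set T : Finset α := Finset.univ.filter fun u => x u = 1 with hT
  have hT1 : ∀ v ∈ T, x v = 1 := by intro v hv; simpa [hT] using hv
  refine ⟨T, ?_, ?_⟩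
  · have h := hxP.2 T
    rw [Finset.sum_congr rfl hT1] at h
    simp only [Finset.sum_const, nsmul_eq_mul, mul_one, Nat.cast_le] at h
    obtain ⟨S, hS, hSi, hSc⟩ := exists_rank M T
    rwa [Finset.eq_of_subset_of_card_le hS (by omega)] at hSi
  · rw [← std_ind f x T hT1 (by
      intro v hv
      rcases hint v with h | h
      · exact h
      · exact absurd (by simpa [hT] using h) hv)]
    exact (show stdMulti f x₀ ≤ stdMulti f x₁ from hmax₁ hx₀).trans hx1

theorem rounding_exists (M : FinMatroid α) (f : Finset α → ℝ)
    (hf_nonneg : ∀ S, 0 ≤ f S)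
    (hf_submod : ∀ S T : Finset α, f (S ∪ T) + f (S ∩ T) ≤ f S + f T)
    (y : Finset α → ℝ) (hy : ∀ S, 0 ≤ y S ∧ y S ≤ 1)
    (hmarg : inMatroidPolytope M (marg y)) :
    ∃ T : Finset α, M.Indep T ∧ extMulti f y ≤ f T := by
  exact part2 M f hf_submod _ hmarg |>.imp fun T h => ⟨h.1, (extMulti_le f hf_submod y hy).trans h.2⟩
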